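/- arXiv:1312.2142 — 4 statements merged into one kernel-verified Lean document; each statement's English description precedes it below -/
import Mathlib

section
/- Let n, k, l be positive integers, Z_f an n×k real matrix, H an l×n real matrix, and R an l×l real symmetric positive definite matrix. Set P_f = Z_f Z_fᵀ, V = (H Z_f)ᵀ, and D = Vᵀ V + R. Then R + H P_f Hᵀ = D is positive definite, and (I − P_f Hᵀ (R + H P_f Hᵀ)⁻¹ H) P_f = Z_f (I − V D⁻¹ Vᵀ) Z_fᵀ. -/
open Matrix

/-- The Potter method: with P_f = Z_f Z_fᵀ, V = (H Z_f)ᵀ and D = Vᵀ V + R, the matrix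
R + H P_f Hᵀ equals D and is positive definite, and the Kalman analysis covariance
(I − P_f Hᵀ (R + H P_f Hᵀ)⁻¹ H) P_f equals the square-root form Z_f (I − V D⁻¹ Vᵀ) Z_fᵀ. -/
theorem stmt_12 (n k l : ℕ) (hn : 0 < n) (hk : 0 < k) (hl : 0 < l)
    (Zf : Matrix (Fin n) (Fin k) ℝ) (H : Matrix (Fin l) (Fin n) ℝ)
    (R : Matrix (Fin l) (Fin l) ℝ) (hR : R.PosDef)
    (Pf : Matrix (Fin n) (Fin n) ℝ) (hPf : Pf = Zf * Zfᵀ)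
    (V : Matrix (Fin k) (Fin l) ℝ) (hV : V = (H * Zf)ᵀ)
    (D : Matrix (Fin l) (Fin l) ℝ) (hD : D = Vᵀ * V + R) :
    R + H * Pf * Hᵀ = D ∧ D.PosDef ∧
    (1 - Pf * Hᵀ * (R + H * Pf * Hᵀ)⁻¹ * H) * Pf = Zf * (1 - V * D⁻¹ * Vᵀ) * Zfᵀ := by
  have hDeq : R + H * Pf * Hᵀ = D := by
    rw [hD, hV, hPf, transpose_transpose, transpose_mul, add_comm]
    simp only [Matrix.mul_assoc]
  refine ⟨hDeq, ?_, ?_⟩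
  · rw [hD]
    have hVV : (Vᵀ * V).PosSemidef := by
      simpa only [conjTranspose_eq_transpose_of_trivial] using posSemidef_conjTranspose_mul_self V
    exact PosDef.posSemidef_add hVV hR
  · rw [hDeq, hPf, hV]
    simp only [transpose_transpose, transpose_mul, Matrix.sub_mul, Matrix.mul_sub,
      Matrix.one_mul, Matrix.mul_one, Matrix.mul_assoc]
end

section
/- Let n, k, l be positive integers, Z_f an n×k real matrix, H an l×n real matrix, and R an l×l real symmetric positive definite matrix. Set P_f = Z_f Z_fᵀ and K = P_f Hᵀ (H P_f Hᵀ + R)⁻¹. Suppose Z_fᵀ Hᵀ R⁻¹ H Z_f = C Γ Cᵀ where C is a k×k real orthogonal matrix and Γ is a k×k diagonal matrix with nonnegative diagonal entries. Then Γ + I is invertible, and the matrix Z_a = Z_f C (Γ + I)^{−1/2} satisfies Z_a Z_aᵀ = (I − K H) P_f; i.e., the ETKF transform produces analysis perturbations whose outer product is exactly the Kalman analysis error covariance. -/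
open Matrix

/-- The Woodbury identity in ensemble space. -/
theorem one_sub_transpose_mul_inv_mul_mul_one_add {m n : Type*} [Fintype m] [DecidableEq m]
    [Fintype n] [DecidableEq n] {R : Matrix m m ℝ} (hR : R.PosDef) (Y : Matrix m n ℝ) :
    (1 - Yᵀ * (Y * Yᵀ + R)⁻¹ * Y) * (1 + Yᵀ * R⁻¹ * Y) = 1 := by
  have hS : (Y * Yᵀ + R).PosDef := by
    have h := PosDef.posSemidef_add (posSemidef_self_mul_conjTranspose Y) hR
    rwa [conjTranspose_eq_transpose_of_trivial] at h
  have hSS : (Y * Yᵀ + R)⁻¹ * (Y * Yᵀ + R) = 1 :=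
    nonsing_inv_mul _ ((isUnit_iff_isUnit_det _).1 hS.isUnit)
  have hRR : R * R⁻¹ = 1 := mul_nonsing_inv _ ((isUnit_iff_isUnit_det _).1 hR.isUnit)
  generalize (Y * Yᵀ + R)⁻¹ = T at hSS ⊢
  have key : T * (Y * Yᵀ) * R⁻¹ = R⁻¹ - T := by
    have h := congrArg (· * R⁻¹) hSS
    simp only [mul_add, add_mul, Matrix.mul_assoc, hRR, mul_one, one_mul] at h
    rw [eq_sub_iff_add_eq]
    simpa only [Matrix.mul_assoc] using h
  have hprod : Yᵀ * T * Y * (Yᵀ * R⁻¹ * Y) = Yᵀ * R⁻¹ * Y - Yᵀ * T * Y := by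
    calc Yᵀ * T * Y * (Yᵀ * R⁻¹ * Y) = Yᵀ * (T * (Y * Yᵀ) * R⁻¹) * Y := by
          simp only [Matrix.mul_assoc]
      _ = _ := by rw [key, Matrix.mul_sub, Matrix.sub_mul]
  rw [sub_mul, one_mul, mul_add, mul_one, hprod]
  abel

/-- The ETKF transform: with P_f = Z_f Z_fᵀ, K = P_f Hᵀ (H P_f Hᵀ + R)⁻¹, and an
eigenvalue decomposition Z_fᵀ Hᵀ R⁻¹ H Z_f = C Γ Cᵀ (C orthogonal, Γ diagonal with
nonnegative entries), the matrix Γ + I is invertible and the analysis perturbations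
Z_a = Z_f C (Γ + I)^{−1/2} satisfy Z_a Z_aᵀ = (I − K H) P_f. -/
theorem stmt_13 (n k l : ℕ) (hn : 0 < n) (hk : 0 < k) (hl : 0 < l)
    (Zf : Matrix (Fin n) (Fin k) ℝ) (H : Matrix (Fin l) (Fin n) ℝ)
    (R : Matrix (Fin l) (Fin l) ℝ) (hR : R.PosDef)
    (Pf : Matrix (Fin n) (Fin n) ℝ) (hPf : Pf = Zf * Zfᵀ)
    (K : Matrix (Fin n) (Fin l) ℝ) (hK : K = Pf * Hᵀ * (H * Pf * Hᵀ + R)⁻¹)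
    (C Γ : Matrix (Fin k) (Fin k) ℝ)
    (hC : Cᵀ * C = 1 ∧ C * Cᵀ = 1)
    (hΓdiag : ∀ i j : Fin k, i ≠ j → Γ i j = 0)
    (hΓnonneg : ∀ i : Fin k, 0 ≤ Γ i i)
    (hdecomp : Zfᵀ * Hᵀ * R⁻¹ * H * Zf = C * Γ * Cᵀ)
    (Za : Matrix (Fin n) (Fin k) ℝ)
    (hZa : Za = Zf * C * Matrix.diagonal fun i => (Real.sqrt (Γ i i + 1))⁻¹) :
    IsUnit (Γ + 1) ∧ Za * Zaᵀ = (1 - K * H) * Pf := by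
  have hpos (i : Fin k) : 0 < Γ i i + 1 := by linarith [hΓnonneg i]
  have hΓ : Γ + 1 = diagonal fun i => Γ i i + 1 := by
    ext i j
    obtain rfl | hij := eq_or_ne i j
    · simp
    · simp [hij, hΓdiag i j hij]
  set D : Matrix (Fin k) (Fin k) ℝ := diagonal fun i => (Real.sqrt (Γ i i + 1))⁻¹ with hD
  have hDD : (Γ + 1) * (D * Dᵀ) = 1 := by
    rw [hΓ, hD, diagonal_transpose, diagonal_mul_diagonal, diagonal_mul_diagonal,
      ← diagonal_one]
    congr 1
    ext i
    rw [← mul_inv, Real.mul_self_sqrt (hpos i).le, mul_inv_cancel₀ (hpos i).ne']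
  refine ⟨IsUnit.of_mul_eq_one _ hDD, ?_⟩
  have hW : (1 + (H * Zf)ᵀ * R⁻¹ * (H * Zf)) * (C * (D * Dᵀ) * Cᵀ) = 1 := by
    have hM : 1 + (H * Zf)ᵀ * R⁻¹ * (H * Zf) = C * (Γ + 1) * Cᵀ := by
      rw [mul_add, add_mul, mul_one, hC.2, ← hdecomp, transpose_mul, add_comm]
      simp only [Matrix.mul_assoc]
    calc _ = C * (Γ + 1) * (Cᵀ * C) * (D * Dᵀ) * Cᵀ := by
          rw [hM]; simp only [Matrix.mul_assoc]
      _ = C * ((Γ + 1) * (D * Dᵀ)) * Cᵀ := by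
          rw [hC.1, mul_one]; simp only [Matrix.mul_assoc]
      _ = 1 := by rw [hDD, mul_one, hC.2]
  have hV := left_inv_eq_right_inv (one_sub_transpose_mul_inv_mul_mul_one_add hR (H * Zf)) hW
  have hS : H * (Zf * Zfᵀ) * Hᵀ = H * Zf * (H * Zf)ᵀ := by
    rw [transpose_mul]; simp only [Matrix.mul_assoc]
  calc Za * Zaᵀ = Zf * (C * (D * Dᵀ) * Cᵀ) * Zfᵀ := by
        rw [hZa]; simp only [transpose_mul, Matrix.mul_assoc]
    _ = (1 - K * H) * Pf := by
        rw [← hV, hK, hPf, hS, transpose_mul]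
        simp only [Matrix.mul_sub, Matrix.sub_mul, Matrix.mul_one, Matrix.one_mul,
          Matrix.mul_assoc]
end

section
/- Let n, k, l be positive integers, Z an n×k real matrix, H an l×n real matrix, and R an l×l real symmetric positive definite matrix. Set P = Z Zᵀ and K = P Hᵀ (H P Hᵀ + R)⁻¹. Then I_k + Zᵀ Hᵀ R⁻¹ H Z is invertible and Z (I_k + Zᵀ Hᵀ R⁻¹ H Z)⁻¹ Zᵀ = (I_n − K H) P. -/
open Matrix

/-- Push-through identity for square-root ensemble filters: with P = Z Zᵀ and
K = P Hᵀ (H P Hᵀ + R)⁻¹, the matrix I + Zᵀ Hᵀ R⁻¹ H Z is invertible and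
Z (I + Zᵀ Hᵀ R⁻¹ H Z)⁻¹ Zᵀ = (I − K H) P. -/
theorem stmt_14 (n k l : ℕ) (hn : 0 < n) (hk : 0 < k) (hl : 0 < l)
    (Z : Matrix (Fin n) (Fin k) ℝ) (H : Matrix (Fin l) (Fin n) ℝ)
    (R : Matrix (Fin l) (Fin l) ℝ) (hR : R.PosDef)
    (P : Matrix (Fin n) (Fin n) ℝ) (hP : P = Z * Zᵀ)
    (K : Matrix (Fin n) (Fin l) ℝ) (hK : K = P * Hᵀ * (H * P * Hᵀ + R)⁻¹) :
    IsUnit (1 + Zᵀ * Hᵀ * R⁻¹ * H * Z) ∧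
    Z * (1 + Zᵀ * Hᵀ * R⁻¹ * H * Z)⁻¹ * Zᵀ = (1 - K * H) * P := by
  subst hP hK
  have hM : (1 + (H * Z)ᵀ * R⁻¹ * (H * Z)).PosDef := by
    have h := hR.inv.posSemidef.conjTranspose_mul_mul_same (H * Z)
    rw [conjTranspose_eq_transpose_of_trivial] at h
    exact PosDef.one.add_posSemidef h
  have hS : (R + H * Z * (H * Z)ᵀ).PosDef := by
    have h := posSemidef_self_mul_conjTranspose (H * Z)
    rw [conjTranspose_eq_transpose_of_trivial] at h
    exact hR.add_posSemidef h
  have hRR : R⁻¹⁻¹ = R := nonsing_inv_nonsing_inv R ((isUnit_iff_isUnit_det R).mp hR.isUnit)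
  have hMeq : 1 + Zᵀ * Hᵀ * R⁻¹ * H * Z = 1 + (H * Z)ᵀ * R⁻¹ * (H * Z) := by
    simp only [transpose_mul, Matrix.mul_assoc]
  have hSeq : H * (Z * Zᵀ) * Hᵀ + R = R + H * Z * (H * Z)ᵀ := by
    simp only [transpose_mul, Matrix.mul_assoc, add_comm]
  have hW := add_mul_mul_inv_eq_sub 1 (H * Z)ᵀ R⁻¹ (H * Z) isUnit_one hR.inv.isUnit
    (by simpa only [hRR, inv_one, Matrix.mul_one] using hS.isUnit)
  rw [hMeq, hSeq]
  refine ⟨hM.isUnit, ?_⟩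
  rw [hW, hRR]
  simp only [inv_one, Matrix.mul_one, Matrix.one_mul, Matrix.mul_sub, Matrix.sub_mul,
    transpose_mul, Matrix.mul_assoc]
end

section
/- Let k ≥ 2, n, l be positive integers, X an n×k real matrix, H an l×n real matrix, and R an l×l real symmetric positive definite matrix. Set Y = H X, P̃ = ((k−1)I_k + Yᵀ R⁻¹ Y)⁻¹, P_b = (1/(k−1)) X Xᵀ, and K = P_b Hᵀ (H P_b Hᵀ + R)⁻¹. Then X P̃ Xᵀ = (I_n − K H) P_b; i.e., the LETKF analysis covariance in model space equals the Kalman analysis error covariance. -/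
open Matrix

/-- The LETKF analysis covariance in model space equals the Kalman analysis error
covariance: with Y = H X, P̃ = ((k−1)I + Yᵀ R⁻¹ Y)⁻¹, P_b = (1/(k−1)) X Xᵀ and
K = P_b Hᵀ (H P_b Hᵀ + R)⁻¹, one has X P̃ Xᵀ = (I − K H) P_b. -/
theorem stmt_16 (k n l : ℕ) (hk : 2 ≤ k) (hn : 0 < n) (hl : 0 < l)
    (X : Matrix (Fin n) (Fin k) ℝ) (H : Matrix (Fin l) (Fin n) ℝ)
    (R : Matrix (Fin l) (Fin l) ℝ) (hR : R.PosDef)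
    (Y : Matrix (Fin l) (Fin k) ℝ) (hY : Y = H * X)
    (P : Matrix (Fin k) (Fin k) ℝ)
    (hP : P = (((k : ℝ) - 1) • (1 : Matrix (Fin k) (Fin k) ℝ) + Yᵀ * R⁻¹ * Y)⁻¹)
    (Pb : Matrix (Fin n) (Fin n) ℝ) (hPb : Pb = (1 / ((k : ℝ) - 1)) • (X * Xᵀ))
    (K : Matrix (Fin n) (Fin l) ℝ) (hK : K = Pb * Hᵀ * (H * Pb * Hᵀ + R)⁻¹) :
    X * P * Xᵀ = (1 - K * H) * Pb := by
  have hc : (0 : ℝ) < (k : ℝ) - 1 := by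
    have : (2 : ℝ) ≤ k := by exact_mod_cast hk
    linarith
  have hA : IsUnit (((k : ℝ) - 1) • (1 : Matrix (Fin k) (Fin k) ℝ)) :=
    (Matrix.PosDef.one.smul hc).isUnit
  have hAinv : (((k : ℝ) - 1) • (1 : Matrix (Fin k) (Fin k) ℝ))⁻¹
      = (1 / ((k : ℝ) - 1)) • (1 : Matrix (Fin k) (Fin k) ℝ) := by
    apply Matrix.inv_eq_right_inv
    rw [smul_mul_smul_comm, one_mul, mul_one_div_cancel hc.ne', one_smul]
  have hRR : R⁻¹⁻¹ = R :=
    Matrix.nonsing_inv_nonsing_inv R ((Matrix.isUnit_iff_isUnit_det R).mp hR.isUnit)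
  have hYAY : Y * (((k : ℝ) - 1) • (1 : Matrix (Fin k) (Fin k) ℝ))⁻¹ * Yᵀ = H * Pb * Hᵀ := by
    simp [hAinv, hY, hPb, Matrix.mul_assoc]
  have hPbHt : (H * Pb * Hᵀ).PosSemidef := by
    rw [hPb]
    have h := ((Matrix.posSemidef_self_mul_conjTranspose X).smul
      (one_div_pos.mpr hc).le).mul_mul_conjTranspose_same H
    simpa only [Matrix.conjTranspose_eq_transpose_of_trivial] using h
  have hS : IsUnit (R⁻¹⁻¹ + Y * (((k : ℝ) - 1) • (1 : Matrix (Fin k) (Fin k) ℝ))⁻¹ * Yᵀ) := by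
    rw [hRR, hYAY]
    exact (hR.add_posSemidef hPbHt).isUnit
  rw [hP, Matrix.add_mul_mul_inv_eq_sub _ _ _ _ hA hR.inv.isUnit hS, hRR, hYAY, hAinv, hK,
    add_comm R, hPb, hY]
  simp [Matrix.mul_sub, Matrix.sub_mul, Matrix.mul_assoc, smul_sub]
end
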